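/- Every solvable subgroup of the braid group B₃ that contains the generator σ₁ is abelian. -/

import Mathlib

open Matrix LaurentPolynomial
open scoped MatrixGroups

noncomputable section

/-- The braid relation σ₁σ₂σ₁ = σ₂σ₁σ₂ as a relator in the free group on two generators. -/
def braidRel : Set (FreeGroup (Fin 2)) :=
  {FreeGroup.of 0 * FreeGroup.of 1 * FreeGroup.of 0 *
    (FreeGroup.of 1 * FreeGroup.of 0 * FreeGroup.of 1)⁻¹}

/-- The braid group B₃ on three strands. -/
abbrev B3 : Type := PresentedGroup braidRel

/-- The first Artin generator σ₁ of B₃. -/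
def σ₁ : B3 := PresentedGroup.of 0

/-- The second Artin generator σ₂ of B₃. -/
def σ₂ : B3 := PresentedGroup.of 1

/-- The Garside element (half twist) of B₃. -/
def Δ : B3 := σ₁ * σ₂ * σ₁

theorem braid_relation : σ₁ * σ₂ * σ₁ = σ₂ * σ₁ * σ₂ := by
  have h := PresentedGroup.one_of_mem (rels := braidRel) (Set.mem_singleton _)
  rw [map_mul, map_inv, mul_inv_eq_one] at h
  simp only [map_mul] at h
  exact h

theorem halfTwist_mul_sigma1 : Δ * σ₁ = σ₂ * Δ := by
  rw [Δ, braid_relation]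
  simp only [mul_assoc]
  rw [← mul_assoc σ₁ σ₂ σ₁, braid_relation, mul_assoc]

theorem halfTwist_mul_sigma2 : Δ * σ₂ = σ₁ * Δ := by
  conv_rhs => rw [Δ, braid_relation]
  simp only [Δ, mul_assoc]

theorem commute_halfTwist_sq_sigma1 : Commute (Δ ^ 2) σ₁ := by
  rw [Commute, SemiconjBy, sq, mul_assoc, halfTwist_mul_sigma1, ← mul_assoc, halfTwist_mul_sigma2,
    mul_assoc]

theorem commute_halfTwist_sq_sigma2 : Commute (Δ ^ 2) σ₂ := by
  rw [Commute, SemiconjBy, sq, mul_assoc, halfTwist_mul_sigma2, ← mul_assoc, halfTwist_mul_sigma1,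
    mul_assoc]

theorem closure_sigma : Subgroup.closure {σ₁, σ₂} = (⊤ : Subgroup B3) := by
  rw [← PresentedGroup.closure_range_of braidRel]
  congr 1
  ext x
  simp [Fin.exists_fin_two, σ₁, σ₂, eq_comm]

theorem commute_halfTwist_sq (g : B3) : Commute (Δ ^ 2) g := by
  have hg : g ∈ Subgroup.closure {σ₁, σ₂} := closure_sigma ▸ Subgroup.mem_top g
  induction hg using Subgroup.closure_induction with
  | mem x hx =>
    rcases hx with rfl | rfl
    exacts [commute_halfTwist_sq_sigma1, commute_halfTwist_sq_sigma2]
  | one => exact Commute.one_right _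
  | mul x y _ _ hx hy => exact hx.mul_right hy
  | inv x _ hx => exact hx.inv_right

/-- The subgroup generated by σ₁ and the full twist. -/
def parabolic : Subgroup B3 := Subgroup.closure {σ₁, Δ ^ 2}

theorem sigma1_mem_parabolic : σ₁ ∈ parabolic := Subgroup.subset_closure (by simp)

theorem halfTwist_sq_mem_parabolic : Δ ^ 2 ∈ parabolic := Subgroup.subset_closure (by simp)

theorem parabolic_comm {a b : B3} (ha : a ∈ parabolic) (hb : b ∈ parabolic) : a * b = b * a := by
  induction ha, hb using Subgroup.closure_induction₂ with
  | mem x y hx hy =>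
    rcases hx with rfl | rfl
    · rcases hy with rfl | rfl
      exacts [rfl, (commute_halfTwist_sq σ₁).symm]
    · exact commute_halfTwist_sq y
  | one_left x _ => exact Commute.one_left x
  | one_right x _ => exact Commute.one_right x
  | mul_left x y z _ _ _ hx hy => exact Commute.mul_left hx hy
  | mul_right y z x _ _ _ hy hz => exact Commute.mul_right hy hz
  | inv_left x y _ _ h => exact Commute.inv_left h
  | inv_right x y _ _ h => exact Commute.inv_right h

/-- The monoid generated by the elements acting through nonnegative matrices. -/
def positiveMonoid : Submonoid B3 := Submonoid.closure {σ₁, σ₂⁻¹}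

theorem sigma1_mem_positiveMonoid : σ₁ ∈ positiveMonoid := Submonoid.subset_closure (by simp)

theorem sigma2_inv_mem_positiveMonoid : σ₂⁻¹ ∈ positiveMonoid := Submonoid.subset_closure (by simp)

theorem sigma1_mul_halfTwist_mul_sigma1 : σ₁ * Δ * σ₁ = σ₂⁻¹ * Δ ^ 2 := by
  rw [mul_assoc, halfTwist_mul_sigma1, eq_inv_mul_iff_mul_eq, sq]
  nth_rw 2 [Δ]
  rw [braid_relation]
  simp only [mul_assoc]

theorem sigma1_mul_halfTwist_mul_sigma2_inv : σ₁ * Δ * σ₂⁻¹ = Δ := by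
  rw [mul_inv_eq_iff_eq_mul, halfTwist_mul_sigma2]

/-- The union of the parabolic subgroup and its coset through the half twist. -/
def tails : Set B3 := {t | t ∈ parabolic ∨ Δ * t ∈ parabolic}

theorem halfTwist_mul_mem_tails {t : B3} (ht : t ∈ tails) : Δ * t ∈ tails := by
  rcases ht with ht | ht
  · right
    simpa only [sq, mul_assoc] using mul_mem halfTwist_sq_mem_parabolic ht
  · exact .inl ht

theorem halfTwist_inv_mul_mem_tails {t : B3} (ht : t ∈ tails) : Δ⁻¹ * t ∈ tails := by
  rcases ht with ht | ht
  · exact .inr (by rwa [mul_inv_cancel_left])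
  · left
    simpa only [sq, _root_.mul_inv_rev, mul_assoc, inv_mul_cancel_left] using
      mul_mem (inv_mem halfTwist_sq_mem_parabolic) ht

/-- The products of a positive element and a tail, with possibly a half twist in front. -/
def normalForms : Set B3 :=
  {g | ∃ p ∈ positiveMonoid, ∃ t ∈ tails, g = p * t ∨ g = Δ * (p * t)}

theorem halfTwist_mul_mem_normalForms {g : B3} (hg : g ∈ normalForms) : Δ * g ∈ normalForms := by
  obtain ⟨p, hp, t, ht, rfl | rfl⟩ := hg
  · exact ⟨p, hp, t, ht, .inr rfl⟩
  · refine ⟨p, hp, _, halfTwist_mul_mem_tails (halfTwist_mul_mem_tails ht), .inl ?_⟩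
    have h := (commute_halfTwist_sq p).eq
    simp only [sq] at h
    simp only [← mul_assoc]
    rw [h]
    simp only [← mul_assoc]

theorem halfTwist_inv_mul_mem_normalForms {g : B3} (hg : g ∈ normalForms) :
    Δ⁻¹ * g ∈ normalForms := by
  obtain ⟨p, hp, t, ht, rfl | rfl⟩ := hg
  · refine ⟨p, hp, _, halfTwist_inv_mul_mem_tails (halfTwist_inv_mul_mem_tails ht), .inr ?_⟩
    have h := (commute_halfTwist_sq p).inv_left.eq
    rw [sq, _root_.mul_inv_rev] at h
    rw [eq_comm, ← mul_assoc Δ⁻¹, ← mul_assoc p, ← h]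
    simp only [mul_assoc, mul_inv_cancel_left]
  · exact ⟨p, hp, t, ht, .inl (inv_mul_cancel_left _ _)⟩

theorem sigma1_mul_mem_normalForms {g : B3} (hg : g ∈ normalForms) : σ₁ * g ∈ normalForms := by
  obtain ⟨p, hp, t, ht, rfl | rfl⟩ := hg
  · exact ⟨_, mul_mem sigma1_mem_positiveMonoid hp, t, ht, .inl (mul_assoc _ _ _).symm⟩
  · induction hp using Submonoid.closure_induction_left with
    | one =>
      exact ⟨_, sigma1_mem_positiveMonoid, _, halfTwist_mul_mem_tails ht, .inl (by rw [one_mul])⟩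
    | mul_left x hx p hp _ =>
      rcases hx with rfl | rfl
      · refine ⟨_, mul_mem sigma2_inv_mem_positiveMonoid hp, _,
          halfTwist_mul_mem_tails (halfTwist_mul_mem_tails ht), .inl ?_⟩
        rw [mul_assoc, ← mul_assoc, ← mul_assoc, sigma1_mul_halfTwist_mul_sigma1, mul_assoc,
          ← mul_assoc _ p, (commute_halfTwist_sq p).eq]
        simp only [sq, mul_assoc]
      · exact ⟨p, hp, t, ht, .inr (by
          rw [mul_assoc, ← mul_assoc, ← mul_assoc, sigma1_mul_halfTwist_mul_sigma2_inv])⟩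

theorem sigma2_inv_eq : σ₂⁻¹ = σ₁ * Δ⁻¹ * σ₁ := by
  simp only [Δ, _root_.mul_inv_rev, mul_assoc, inv_mul_cancel, mul_inv_cancel_left, mul_one]

theorem sigma1_inv_eq : σ₁⁻¹ = Δ * σ₂⁻¹ * Δ⁻¹ := by
  rw [eq_mul_inv_iff_mul_eq, eq_mul_inv_iff_mul_eq, mul_assoc, halfTwist_mul_sigma2,
    inv_mul_cancel_left]

theorem sigma2_eq : σ₂ = Δ * σ₁ * Δ⁻¹ := by
  rw [halfTwist_mul_sigma1, mul_inv_cancel_right]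

theorem mem_normalForms (g : B3) : g ∈ normalForms := by
  have hg : g ∈ Subgroup.closure {σ₁, σ₂} := closure_sigma ▸ Subgroup.mem_top g
  have sigma2_inv_mul {y : B3} (hy : y ∈ normalForms) : σ₂⁻¹ * y ∈ normalForms := by
    rw [sigma2_inv_eq, mul_assoc, mul_assoc]
    exact sigma1_mul_mem_normalForms <| halfTwist_inv_mul_mem_normalForms <|
      sigma1_mul_mem_normalForms hy
  induction hg using Subgroup.closure_induction_left with
  | one => exact ⟨1, one_mem _, 1, .inl (one_mem _), .inl (one_mul 1).symm⟩
  | mul_left x hx y _ hy =>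
    rcases hx with rfl | rfl
    · exact sigma1_mul_mem_normalForms hy
    · rw [sigma2_eq, mul_assoc, mul_assoc]
      exact halfTwist_mul_mem_normalForms <| sigma1_mul_mem_normalForms <|
        halfTwist_inv_mul_mem_normalForms hy
  | inv_mul_cancel x hx y _ hy =>
    rcases hx with rfl | rfl
    · rw [sigma1_inv_eq, mul_assoc, mul_assoc]
      exact halfTwist_mul_mem_normalForms <| sigma2_inv_mul <|
        halfTwist_inv_mul_mem_normalForms hy
    · exact sigma2_inv_mul hy

/-- The images of the two Artin generators in SL(2, ℤ). -/
def sigmaMatrix : Fin 2 → SL(2, ℤ) :=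
  ![⟨!![1, 1; 0, 1], by simp⟩, ⟨!![1, 0; -1, 1], by simp⟩]

/-- The reduced integral Burau representation of B₃ (at `t = -1`), with values in SL(2, ℤ). -/
def toSL2 : B3 →* SL(2, ℤ) :=
  PresentedGroup.toGroup (f := sigmaMatrix) <| by
    rintro r rfl
    simp only [map_mul, map_inv, FreeGroup.lift_apply_of, mul_inv_eq_one]
    decide

theorem toSL2_sigma1 : toSL2 σ₁ = sigmaMatrix 0 := PresentedGroup.toGroup.of _

theorem toSL2_sigma2 : toSL2 σ₂ = sigmaMatrix 1 := PresentedGroup.toGroup.of _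

/-- The reduced integral Burau representation of B₃ (at `t = -1`), as a matrix. -/
def burau : B3 →* Matrix (Fin 2) (Fin 2) ℤ where
  toFun g := (toSL2 g).val
  map_one' := by rw [map_one]; rfl
  map_mul' a b := by rw [map_mul]; rfl

theorem det_burau (g : B3) : (burau g).det = 1 := (toSL2 g).det_coe

theorem burau_inv (g : B3) :
    burau g⁻¹ = !![burau g 1 1, -burau g 0 1; -burau g 1 0, burau g 0 0] := by
  rw [← adjugate_fin_two, show burau g = (toSL2 g).val from rfl,
    ← Matrix.SpecialLinearGroup.coe_inv, ← map_inv]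
  rfl

theorem burau_sigma1 : burau σ₁ = !![1, 1; 0, 1] :=
  congrArg Subtype.val toSL2_sigma1

theorem burau_sigma2 : burau σ₂ = !![1, 0; -1, 1] :=
  congrArg Subtype.val toSL2_sigma2

theorem burau_halfTwist : burau Δ = !![0, 1; -1, 0] := by
  simp [Δ, burau_sigma1, burau_sigma2]

/-- The elements of B₃ whose matrix is upper triangular. -/
def upperTriangular : Subgroup B3 where
  carrier := {g | burau g 1 0 = 0}
  one_mem' := by simp
  mul_mem' {a b} ha hb := by
    simp only [Set.mem_ofPred_eq] at ha hb ⊢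
    simp [Matrix.mul_apply, ha, hb]
  inv_mem' {a} ha := by
    simp only [Set.mem_ofPred_eq] at ha ⊢
    simp [burau_inv, ha]

theorem mem_upperTriangular {g : B3} : g ∈ upperTriangular ↔ burau g 1 0 = 0 := Iff.rfl

theorem parabolic_le_upperTriangular : parabolic ≤ upperTriangular := by
  rw [parabolic, Subgroup.closure_le]
  rintro x (rfl | rfl)
  · simp [mem_upperTriangular, burau_sigma1]
  · simp [mem_upperTriangular, sq, burau_halfTwist]

theorem burau_positive {p : B3} (hp : p ∈ positiveMonoid) :
    (0 < burau p 0 0 ∧ 0 ≤ burau p 0 1 ∧ 0 ≤ burau p 1 0 ∧ 0 < burau p 1 1) ∧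
      (burau p 1 0 = 0 → p ∈ parabolic) ∧ (burau p 0 1 = 0 → Δ * p * Δ⁻¹ ∈ parabolic) := by
  induction hp using Submonoid.closure_induction_left with
  | one => simp
  | mul_left x hx p _ ih =>
    obtain ⟨⟨ha, hb, hc, hd⟩, hpar, hconj⟩ := ih
    rcases hx with rfl | rfl
    · simp only [map_mul, burau_sigma1, Matrix.mul_apply, Fin.sum_univ_two, Fin.isValue, of_apply,
        cons_val', cons_val_zero, cons_val_one, cons_val_fin_one, one_mul, zero_mul, zero_add]
      exact ⟨by omega, fun h => mul_mem sigma1_mem_parabolic (hpar h), fun h => by omega⟩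
    · simp [burau_inv, burau_sigma2, Matrix.mul_apply]
      refine ⟨by omega, fun h => by omega, fun h => ?_⟩
      have := mul_mem (inv_mem sigma1_mem_parabolic) (hconj h)
      rw [sigma1_inv_eq] at this
      simpa only [mul_assoc, inv_mul_cancel_left] using this

theorem upperTriangular_le_parabolic : upperTriangular ≤ parabolic := by
  intro g hg
  obtain ⟨p, hp, t, ht, h⟩ := mem_normalForms g
  obtain ⟨⟨ha, -, -, hd⟩, hpar, hconj⟩ := burau_positive hp
  rcases ht with ht | ht <;> rcases h with rfl | rfl
  · have := (Subgroup.mul_mem_cancel_right _ (parabolic_le_upperTriangular ht)).1 hg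
    exact mul_mem (hpar this) ht
  · rw [← mul_assoc] at hg
    have := (Subgroup.mul_mem_cancel_right _ (parabolic_le_upperTriangular ht)).1 hg
    simp [mem_upperTriangular, burau_halfTwist, Matrix.mul_apply] at this
    omega
  · have hg' : p * Δ⁻¹ * (Δ * t) ∈ upperTriangular := by simpa [mul_assoc] using hg
    have := (Subgroup.mul_mem_cancel_right _ (parabolic_le_upperTriangular ht)).1 hg'
    simp [mem_upperTriangular, burau_inv, burau_halfTwist, Matrix.mul_apply] at this
    omega
  · have hg' : Δ * p * Δ⁻¹ * (Δ * t) ∈ upperTriangular := by simpa [mul_assoc] using hg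
    have := (Subgroup.mul_mem_cancel_right _ (parabolic_le_upperTriangular ht)).1 hg'
    simp [mem_upperTriangular, burau_inv, burau_halfTwist, Matrix.mul_apply, Fin.sum_univ_two,
      vecMul_eq_sum] at this
    simpa [mul_assoc] using mul_mem (hconj this) ht

open scoped commutatorElement

theorem mem_upperTriangular_of_commutator_mem {a : B3}
    (h : ⁅a, σ₁ * a * σ₁⁻¹⁆ ∈ upperTriangular) : a ∈ upperTriangular := by
  generalize he : ⁅a, σ₁ * a * σ₁⁻¹⁆ = e at h
  rw [mem_upperTriangular] at h
  have hmul : a * (σ₁ * a * σ₁⁻¹) = e * ((σ₁ * a * σ₁⁻¹) * a) := by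
    rw [← he, commutatorElement_def]
    group
  have hmat := congrArg burau hmul
  have hinv : burau σ₁⁻¹ = !![1, -1; 0, 1] := by
    rw [burau_inv, burau_sigma1]
    simp
  simp only [map_mul, burau_sigma1, hinv] at hmat
  have h10 := congrFun (congrFun hmat 1) 0
  have h11 := congrFun (congrFun hmat 1) 1
  have hdet := det_burau a
  have hdet' := det_burau e
  rw [det_fin_two] at hdet hdet'
  simp only [Matrix.mul_apply, Fin.sum_univ_two, Fin.isValue, of_apply, cons_val',
    cons_val_zero, cons_val_one, cons_val_fin_one, h] at h10 h11
  ring_nf at h10 h11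
  rw [h, mul_zero, sub_zero] at hdet'
  rw [mem_upperTriangular]
  generalize burau a 0 0 = p at *
  generalize burau a 0 1 = q at *
  generalize burau a 1 0 = r at *
  generalize burau a 1 1 = s at *
  by_contra hr
  rcases Int.eq_one_or_neg_one_of_mul_eq_one' hdet' with ⟨-, hx⟩ | ⟨-, hx⟩ <;>
    rw [hx] at h10 h11
  · have : r * r = 0 := by linarith
    simp_all
  · have hs : s = -p := by
      have : r * (p + s) = 0 := by linarith
      have := (mul_eq_zero.1 this).resolve_left hr
      linarith
    subst hs
    nlinarith [sq_nonneg r]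

theorem le_upperTriangular_of_isSolvable {H : Subgroup B3} (hsolv : Group.IsSolvable H)
    (hmem : σ₁ ∈ H) : H ≤ upperTriangular := by
  have key (n : ℕ) (hn : (derivedSeries H n).map H.subtype ≤ upperTriangular) :
      (derivedSeries H 0).map H.subtype ≤ upperTriangular := by
    induction n with
    | zero => exact hn
    | succ n ih =>
      refine ih ?_
      rintro _ ⟨a, ha, rfl⟩
      refine mem_upperTriangular_of_commutator_mem
        (hn ⟨⁅a, ⟨σ₁, hmem⟩ * a * ⟨σ₁, hmem⟩⁻¹⁆, ?_, rfl⟩)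
      exact Subgroup.commutator_mem_commutator ha ((derivedSeries_normal H n).conj_mem a ha _)
  obtain ⟨n, hn⟩ := hsolv
  simpa [← MonoidHom.range_eq_map] using key n (by simp [hn])

/-- **Solvable subgroups containing σ₁.** Every solvable subgroup of the braid group B₃
that contains the generator σ₁ is abelian. -/
theorem solvable_subgroup_containing_sigma1_abelian (H : Subgroup B3)
    (hsolv : IsSolvable H) (hmem : σ₁ ∈ H) :
    ∀ a ∈ H, ∀ b ∈ H, a * b = b * a := by
  intro a ha b hb
  have hH := (le_upperTriangular_of_isSolvable hsolv hmem).trans upperTriangular_le_parabolic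
  exact parabolic_comm (hH ha) (hH hb)
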